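/- Suppose the pair (μ₁,μ₂) is perfect, let n ≥ 0 and m ≥ 1, and suppose real numbers c, a, b satisfy P_{n+1,m}(x) = (x − c)P_{n,m}(x) − a P_{n−1,m}(x) − b P_{n,m−1}(x) (the term with P_{n−1,m} omitted if n = 0). Then b = S_{n,m+1} S_{n,m−1} / S_{n,m}²; in particular b ≠ 0. -/

import Mathlib

open MeasureTheory Polynomial

/-- The `k`-th moment of a measure `μ` on `ℝ`. -/
noncomputable def mom (μ : Measure ℝ) (k : ℕ) : ℝ := ∫ x, x ^ k ∂μ

/-- The `(n+m)×(n+m)` moment matrix of the pair `(μ₁, μ₂)`: column `j` contains the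
moments `s_{i+j}^{(1)}` for `j < n` and `s_{i+j-n}^{(2)}` for `n ≤ j < n+m`. -/
noncomputable def Smat (μ₁ μ₂ : Measure ℝ) (n m : ℕ) :
    Matrix (Fin (n + m)) (Fin (n + m)) ℝ :=
  Matrix.of fun i j =>
    if (j : ℕ) < n then mom μ₁ ((i : ℕ) + (j : ℕ))
    else mom μ₂ ((i : ℕ) + (j : ℕ) - n)

/-- The determinant `S_{n,m}` (with `S_{0,0} = 1`). -/
noncomputable def Sdet (μ₁ μ₂ : Measure ℝ) (n m : ℕ) : ℝ := (Smat μ₁ μ₂ n m).det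

/-- The `(n+m+1)×(n+m+1)` matrix over `ℝ[x]` whose determinant (normalized by `S_{n,m}`)
gives the multiple orthogonal polynomial `P_{n,m}`. -/
noncomputable def Pmat (μ₁ μ₂ : Measure ℝ) (n m : ℕ) :
    Matrix (Fin (n + m + 1)) (Fin (n + m + 1)) (Polynomial ℝ) :=
  Matrix.of fun i j =>
    if (j : ℕ) < n then C (mom μ₁ ((i : ℕ) + (j : ℕ)))
    else if (j : ℕ) < n + m then C (mom μ₂ ((i : ℕ) + (j : ℕ) - n))
    else X ^ (i : ℕ)

/-- The multiple orthogonal (Hermite–Padé) polynomial `P_{n,m}`. -/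
noncomputable def Ppoly (μ₁ μ₂ : Measure ℝ) (n m : ℕ) : Polynomial ℝ :=
  (Sdet μ₁ μ₂ n m)⁻¹ • (Pmat μ₁ μ₂ n m).det

/-- The linear functional on polynomials sending `X ^ k` to the `k`-th moment of `μ`. -/
noncomputable def momentFunctional (μ : Measure ℝ) : ℝ[X] →ₗ[ℝ] ℝ :=
  Polynomial.lsum fun k => mom μ k • LinearMap.id

lemma momentFunctional_C_mul_X_pow (μ : Measure ℝ) (r : ℝ) (k : ℕ) :
    momentFunctional μ (C r * X ^ k) = r * mom μ k := by
  rw [momentFunctional, C_mul_X_pow_eq_monomial, Polynomial.lsum_apply,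
    Polynomial.sum_monomial_index _ _ (by simp)]
  simp [mul_comm]

/-- The moment matrix of `P_{n,m}` with its last column replaced by `s_{i+k}^{(2)}`. -/
noncomputable def borderedMat (μ₁ μ₂ : Measure ℝ) (n m k : ℕ) :
    Matrix (Fin (n + m + 1)) (Fin (n + m + 1)) ℝ :=
  Matrix.of fun i j =>
    if (j : ℕ) < n then mom μ₁ ((i : ℕ) + (j : ℕ))
    else if (j : ℕ) < n + m then mom μ₂ ((i : ℕ) + (j : ℕ) - n)
    else mom μ₂ ((i : ℕ) + k)

lemma momentFunctional_X_pow_mul_det_Pmat (μ₁ μ₂ : Measure ℝ) (n m k : ℕ) :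
    momentFunctional μ₂ (X ^ k * (Pmat μ₁ μ₂ n m).det) = (borderedMat μ₁ μ₂ n m k).det := by
  rw [Matrix.det_succ_column _ (Fin.last _), Matrix.det_succ_column _ (Fin.last _),
    Finset.mul_sum, map_sum]
  refine Finset.sum_congr rfl fun i _ => ?_
  have hminor : (Pmat μ₁ μ₂ n m).submatrix i.succAbove (Fin.last (n + m)).succAbove =
      (C : ℝ →+* ℝ[X]).mapMatrix
        ((borderedMat μ₁ μ₂ n m k).submatrix i.succAbove (Fin.last (n + m)).succAbove) := by
    ext1 p q
    simp only [Pmat, borderedMat, Matrix.submatrix_apply, Matrix.of_apply,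
      RingHom.mapMatrix_apply, Matrix.map_apply, Fin.succAbove_last, Fin.val_castSucc, q.isLt,
      if_true]
    split_ifs <;> rfl
  rw [hminor, ← RingHom.map_det]
  have hcol : Pmat μ₁ μ₂ n m i (Fin.last (n + m)) = X ^ (i : ℕ) := by simp [Pmat]
  have hcol' : borderedMat μ₁ μ₂ n m k i (Fin.last (n + m)) = mom μ₂ (i + k) := by
    simp [borderedMat]
  rw [hcol, hcol']
  set d := ((borderedMat μ₁ μ₂ n m k).submatrix i.succAbove (Fin.last (n + m)).succAbove).det
  set e : ℕ := (i : ℕ) + (Fin.last (n + m) : ℕ)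
  have hterm : (X : ℝ[X]) ^ k * ((-1) ^ e * X ^ (i : ℕ) * C d) =
      C ((-1) ^ e * d) * X ^ ((i : ℕ) + k) := by
    simp only [C_mul, C_pow, C_neg, C_1]
    ring
  rw [hterm, momentFunctional_C_mul_X_pow]
  ring

lemma momentFunctional_X_pow_mul_Ppoly (μ₁ μ₂ : Measure ℝ) (n m k : ℕ) :
    momentFunctional μ₂ (X ^ k * Ppoly μ₁ μ₂ n m) =
      (Sdet μ₁ μ₂ n m)⁻¹ * (borderedMat μ₁ μ₂ n m k).det := by
  rw [Ppoly, mul_smul_comm, map_smul, momentFunctional_X_pow_mul_det_Pmat, smul_eq_mul]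

/-- Orthogonality of `P_{n,m}` to low powers with respect to `μ₂`. -/
lemma momentFunctional_X_pow_mul_Ppoly_eq_zero (μ₁ μ₂ : Measure ℝ) (n : ℕ) {m k : ℕ}
    (hk : k < m) : momentFunctional μ₂ (X ^ k * Ppoly μ₁ μ₂ n m) = 0 := by
  rw [momentFunctional_X_pow_mul_Ppoly,
    Matrix.det_zero_of_column_eq (i := (⟨n + k, by omega⟩ : Fin (n + m + 1)))
      (j := Fin.last (n + m)), mul_zero]
  · simp only [ne_eq, Fin.ext_iff, Fin.val_last]
    omega
  · intro i
    have h : (i : ℕ) + (n + k) - n = i + k := by omega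
    simp [borderedMat, hk, h]

lemma momentFunctional_X_pow_self_mul_Ppoly (μ₁ μ₂ : Measure ℝ) (n m : ℕ) :
    momentFunctional μ₂ (X ^ m * Ppoly μ₁ μ₂ n m) =
      (Sdet μ₁ μ₂ n m)⁻¹ * Sdet μ₁ μ₂ n (m + 1) := by
  rw [momentFunctional_X_pow_mul_Ppoly, Sdet, Sdet]
  congr 2
  ext i j
  change Fin (n + m + 1) at j
  have hj := j.isLt
  change _ = if (j : ℕ) < n then mom μ₁ ((i : ℕ) + (j : ℕ)) else mom μ₂ ((i : ℕ) + (j : ℕ) - n)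
  simp only [borderedMat, Matrix.of_apply]
  split_ifs
  · rfl
  · rfl
  · congr 1
    omega

/-- For a perfect system, the recurrence coefficient `b` in the nearest-neighbor
recurrence in the `n`-direction equals `S_{n,m+1} S_{n,m-1} / S_{n,m}²`;
in particular it is nonzero. -/
theorem recurrence_coefficient_b (μ₁ μ₂ : Measure ℝ)
    (h₁ : ∀ k : ℕ, Integrable (fun x => x ^ k) μ₁)
    (h₂ : ∀ k : ℕ, Integrable (fun x => x ^ k) μ₂)
    (hperfect : ∀ n m : ℕ, Sdet μ₁ μ₂ n m ≠ 0)
    (n m : ℕ) (hm : 1 ≤ m) (c a b : ℝ)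
    (hrec : Ppoly μ₁ μ₂ (n + 1) m =
      (X - C c) * Ppoly μ₁ μ₂ n m
        - (if n = 0 then 0 else C a * Ppoly μ₁ μ₂ (n - 1) m)
        - C b * Ppoly μ₁ μ₂ n (m - 1)) :
    b = Sdet μ₁ μ₂ n (m + 1) * Sdet μ₁ μ₂ n (m - 1) / (Sdet μ₁ μ₂ n m) ^ 2 ∧ b ≠ 0 := by
  obtain ⟨m, rfl⟩ := Nat.exists_eq_add_of_le' hm
  rw [Nat.add_sub_cancel] at hrec ⊢
  have h := congrArg (fun p => momentFunctional μ₂ (X ^ m * p)) hrec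
  have hsplit : (X : ℝ[X]) ^ m * ((X - C c) * Ppoly μ₁ μ₂ n (m + 1)) =
      X ^ (m + 1) * Ppoly μ₁ μ₂ n (m + 1) - c • (X ^ m * Ppoly μ₁ μ₂ n (m + 1)) := by
    rw [smul_eq_C_mul]
    ring
  have ha : momentFunctional μ₂
      (X ^ m * if n = 0 then 0 else C a * Ppoly μ₁ μ₂ (n - 1) (m + 1)) = 0 := by
    split_ifs
    · simp
    · rw [← smul_eq_C_mul, mul_smul_comm, map_smul,
        momentFunctional_X_pow_mul_Ppoly_eq_zero _ _ _ m.lt_succ_self, smul_zero]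
  beta_reduce at h
  have horth := momentFunctional_X_pow_mul_Ppoly_eq_zero μ₁ μ₂
  rw [mul_sub, mul_sub, hsplit, ← smul_eq_C_mul b, mul_smul_comm, map_sub, map_sub, map_sub, ha,
    map_smul, map_smul, horth (n + 1) m.lt_succ_self, horth n m.lt_succ_self,
    momentFunctional_X_pow_self_mul_Ppoly, momentFunctional_X_pow_self_mul_Ppoly, smul_zero,
    sub_zero, sub_zero, smul_eq_mul] at h
  have h0 := hperfect n m
  have h1 := hperfect n (m + 1)
  have h2 := hperfect n (m + 1 + 1)
  have hb : b = Sdet μ₁ μ₂ n (m + 1 + 1) * Sdet μ₁ μ₂ n m / (Sdet μ₁ μ₂ n (m + 1)) ^ 2 := by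
    field_simp at h ⊢
    linear_combination h
  exact ⟨hb, hb ▸ by positivity⟩
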